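/- Let K be an algebraically closed field of characteristic zero and let d ≥ 2 be an integer. Then there exists a form F ∈ K[x,y,z] of degree d whose Waring rank satisfies rk F ≥ ⌊(d² + 2d + 5)/4⌋; equivalently, the maximum Waring rank r_max(3,d) of ternary forms of degree d satisfies r_max(3,d) ≥ ⌊(d² + 2d + 5)/4⌋. -/

import Mathlib

open MvPolynomial

/-- The Waring rank of a ternary form `F` with respect to degree `d`:
the least `r` such that `F` is a linear combination of `r` `d`-th powers
of linear forms. -/
noncomputable def waringRank {K : Type*} [Field K] (d : ℕ)
    (F : MvPolynomial (Fin 3) K) : ℕ :=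
  sInf {r : ℕ | ∃ (c : Fin r → K) (ℓ : Fin r → MvPolynomial (Fin 3) K),
    (∀ i, (ℓ i).IsHomogeneous 1) ∧ F = ∑ i, c i • ℓ i ^ d}

/-- The exponent vector `(m, p, q)` of the ternary monomial `x ^ m * y ^ p * z ^ q`. -/
noncomputable def ternaryExponent (m p q : ℕ) : Fin 3 →₀ ℕ :=
  Finsupp.equivFunOnFinite.symm ![m, p, q]

theorem ternaryExponent_inj {m p q m' p' q' : ℕ} :
    ternaryExponent m p q = ternaryExponent m' p' q' ↔ m = m' ∧ p = p' ∧ q = q' := by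
  simp [ternaryExponent]

theorem ternaryExponent_degree (m p q : ℕ) : (ternaryExponent m p q).degree = m + p + q := by
  simp [ternaryExponent, Finsupp.degree_eq_sum, Fin.sum_univ_three]

/-- A linear form is the combination of the variables given by its coefficients. -/
theorem eq_sum_coeff_smul_X_of_isHomogeneous_one {K σ : Type*} [Field K] [Fintype σ]
    {ℓ : MvPolynomial σ K} (hℓ : ℓ.IsHomogeneous 1) :
    ℓ = ∑ i, coeff (Finsupp.single i 1) ℓ • X i := by
  classical
  have hmem := (mem_homogeneousSubmodule 1 ℓ).2 hℓ
  rw [homogeneousSubmodule_one_eq_span_X, Submodule.mem_span_range_iff_exists_fun] at hmem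
  obtain ⟨c, rfl⟩ := hmem
  simp [coeff_sum, coeff_X, Finsupp.single_left_inj]

theorem coeff_pow_of_isHomogeneous_one {K : Type*} [Field K] {ℓ : MvPolynomial (Fin 3) K}
    (hℓ : ℓ.IsHomogeneous 1) (m p q : ℕ) :
    coeff (ternaryExponent m p q) (ℓ ^ (m + p + q)) =
      (ternaryExponent m p q).multinomial *
        (coeff (Finsupp.single 0 1) ℓ ^ m * coeff (Finsupp.single 1 1) ℓ ^ p *
          coeff (Finsupp.single 2 1) ℓ ^ q) := by
  conv_lhs => rw [eq_sum_coeff_smul_X_of_isHomogeneous_one hℓ]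
  rw [coeff_linearCombination_X_pow_of_fintype, if_pos]
  · rw [Finsupp.prod_fintype _ _ (by simp)]
    simp [Fin.prod_univ_three, ternaryExponent]
  · exact ternaryExponent_degree m p q

/-- Powers of linear forms span the space of forms of a given degree. -/
theorem mem_span_pow_of_isHomogeneous {K σ : Type*} [Field K] [CharZero K] [Fintype σ] {d : ℕ}
    {F : MvPolynomial σ K} (hF : F.IsHomogeneous d) :
    F ∈ Submodule.span K {P | ∃ ℓ : MvPolynomial σ K, ℓ.IsHomogeneous 1 ∧ P = ℓ ^ d} := by
  classical
  by_contra hmem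
  obtain ⟨f, hfF, hf⟩ := Submodule.exists_le_ker_of_notMem hmem
  let Q : MvPolynomial σ K := ∑ k ∈ Finset.piAntidiag Finset.univ d,
    monomial (Finsupp.equivFunOnFinite.symm k)
      ((Nat.multinomial Finset.univ k : K) * f (monomial (Finsupp.equivFunOnFinite.symm k) 1))
  have hQ : Q = 0 := by
    refine MvPolynomial.funext fun v => ?_
    have hlin : (∑ i, C (v i) * X i : MvPolynomial σ K).IsHomogeneous 1 :=
      IsHomogeneous.sum _ _ _ fun i _ => isHomogeneous_C_mul_X _ _
    have hzero : f ((∑ i, C (v i) * X i) ^ d) = 0 :=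
      hf (Submodule.subset_span ⟨_, hlin, rfl⟩)
    rw [map_zero, ← hzero, Finset.sum_pow_eq_sum_piAntidiag, map_sum, map_sum]
    refine Finset.sum_congr rfl fun k _ => ?_
    have hterm : ((Nat.multinomial Finset.univ k : ℕ) : MvPolynomial σ K) *
        ∏ i, (C (v i) * X i) ^ k i =
        ((Nat.multinomial Finset.univ k : K) * ∏ i, v i ^ k i) •
          monomial (Finsupp.equivFunOnFinite.symm k) 1 := by
      rw [smul_eq_C_mul, monomial_eq, Finsupp.prod_fintype _ _ (by simp)]
      simp [mul_pow, Finset.prod_mul_distrib, mul_assoc]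
    rw [hterm, map_smul, eval_monomial, Finsupp.prod_fintype _ _ (by simp)]
    simp only [Finsupp.equivFunOnFinite_symm_apply_apply, smul_eq_mul]
    ring
  have hmono : ∀ s : σ →₀ ℕ, s.degree = d → f (monomial s 1) = 0 := by
    intro s hs
    have hcoeff : coeff s Q = 0 := by rw [hQ, coeff_zero]
    have hmem' : (s : σ → ℕ) ∈ Finset.piAntidiag Finset.univ d := by
      simpa [Finsupp.degree_eq_sum] using hs
    rw [coeff_sum, Finset.sum_eq_single_of_mem _ hmem'] at hcoeff
    · have hne : (Nat.multinomial Finset.univ (s : σ → ℕ) : K) ≠ 0 :=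
        Nat.cast_ne_zero.2 (Nat.multinomial_pos _ _).ne'
      simpa [hne] using hcoeff
    · intro k _ hk
      rw [coeff_monomial, if_neg]
      rintro rfl
      exact hk rfl
  refine hfF ?_
  rw [F.as_sum, map_sum]
  refine Finset.sum_eq_zero fun s hs => ?_
  have hs' : s.degree = d := by
    by_contra h
    exact mem_support_iff.1 hs (hF.coeff_eq_zero h)
  rw [← mul_one (coeff s F), ← smul_eq_mul, ← smul_monomial, map_smul, hmono s hs', smul_zero]

/-- A lower bound for the Waring rank of a form can be checked on all its decompositions. -/
theorem le_waringRank {K : Type*} [Field K] [CharZero K] {d N : ℕ}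
    {F : MvPolynomial (Fin 3) K} (hF : F.IsHomogeneous d)
    (h : ∀ (r : ℕ) (c : Fin r → K) (ℓ : Fin r → MvPolynomial (Fin 3) K),
      (∀ i, (ℓ i).IsHomogeneous 1) → F = ∑ i, c i • ℓ i ^ d → N ≤ r) :
    N ≤ waringRank d F := by
  refine le_csInf ?_ ?_
  · obtain ⟨r, c, g, hg⟩ := Submodule.mem_span_set'.1 (mem_span_pow_of_isHomogeneous hF)
    choose ℓ hℓ hgℓ using fun i => (g i).2
    exact ⟨r, c, ℓ, hℓ, by simp_rw [← hg, hgℓ]⟩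
  · rintro r ⟨c, ℓ, hℓ, hsum⟩
    exact h r c ℓ hℓ hsum

/-- The moment of bidegree `(p, q)` of the weighted points `(u i, v i)`, `i ∈ A`. -/
def pointMoment {K ι : Type*} [Field K] (A : Finset ι) (w u v : ι → K) (p q : ℕ) : K :=
  ∑ i ∈ A, w i * u i ^ p * v i ^ q

/-- If the moment matrix of `A` is triangular with nonzero diagonal on a set `E` of bidegrees,
then the monomials with exponents in `E` are independent on the points of `A`, so that `A` has at
least as many elements as `E`. -/
theorem card_le_card_of_pointMoment_triangular {K ι : Type*} [Field K] (A : Finset ι)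
    (w u v : ι → K) (E : Finset (ℕ × ℕ)) (τ : ℕ × ℕ → ℕ × ℕ) (wt : ℕ × ℕ → ℕ)
    (hdiag : ∀ e ∈ E, pointMoment A w u v (e.1 + (τ e).1) (e.2 + (τ e).2) ≠ 0)
    (htri : ∀ e ∈ E, ∀ e' ∈ E, e' ≠ e → wt e' ≤ wt e →
      pointMoment A w u v (e'.1 + (τ e).1) (e'.2 + (τ e).2) = 0) :
    E.card ≤ A.card := by
  classical
  have hli : LinearIndependent K
      (fun (e : E) (i : A) => u i ^ (e : ℕ × ℕ).1 * v i ^ (e : ℕ × ℕ).2) := by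
    rw [Fintype.linearIndependent_iff]
    intro g hg
    by_contra! hne
    obtain ⟨e₀, he₀⟩ := hne
    obtain ⟨e, he, hmax⟩ := Finset.exists_max_image
      (Finset.univ.filter fun e => g e ≠ 0) (fun e => wt e) ⟨e₀, by simpa using he₀⟩
    have hge : g e ≠ 0 := by simpa using he
    have hsum : ∑ e' : E, g e' *
        pointMoment A w u v ((e' : ℕ × ℕ).1 + (τ e).1) ((e' : ℕ × ℕ).2 + (τ e).2) = 0 := by
      simp_rw [pointMoment, Finset.mul_sum]
      rw [Finset.sum_comm]
      refine Finset.sum_eq_zero fun i hi => ?_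
      have hgi := congrFun hg ⟨i, hi⟩
      simp only [Finset.sum_apply, Pi.smul_apply, smul_eq_mul, Pi.zero_apply] at hgi
      rw [← mul_zero (w i * u i ^ (τ e).1 * v i ^ (τ e).2), ← hgi, Finset.mul_sum]
      exact Finset.sum_congr rfl fun e' _ => by ring
    rw [Finset.sum_eq_single e] at hsum
    · exact (mul_ne_zero hge (hdiag e e.2)) hsum
    · intro e' _ hne
      by_cases hg' : g e' = 0
      · rw [hg', zero_mul]
      · rw [htri e e.2 e' e'.2 (fun h => hne (Subtype.ext h)) (hmax e' (by simpa using hg')),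
          mul_zero]
    · simp
  simpa using hli.fintype_card_le_finrank

/-- Suppose the only nonzero moment of total degree at most `a + b` is that of bidegree `(a, b)`.
Then there are at least `(a + 1) * (b + 1)` points, and each element of a set `T` of bidegrees
(with distinct total degrees) paired with a nonzero moment of total degree `a + b + 1` adds one
more. -/
theorem box_card_add_card_le_card {K ι : Type*} [Field K] (A : Finset ι) (w u v : ι → K)
    (a b : ℕ) (hab : pointMoment A w u v a b ≠ 0)
    (hzero : ∀ p q, p + q ≤ a + b → (p, q) ≠ (a, b) → pointMoment A w u v p q = 0)
    (T : Finset (ℕ × ℕ)) (σ : ℕ × ℕ → ℕ × ℕ)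
    (hinj : ∀ e ∈ T, ∀ e' ∈ T, e.1 + e.2 = e'.1 + e'.2 → e = e')
    (hT : ∀ e ∈ T, a < e.1 ∧ a < (σ e).1 ∧ e.1 + e.2 + ((σ e).1 + (σ e).2) = a + b + 1 ∧
      pointMoment A w u v (e.1 + (σ e).1) (e.2 + (σ e).2) ≠ 0) :
    (a + 1) * (b + 1) + T.card ≤ A.card := by
  classical
  let box := Finset.range (a + 1) ×ˢ Finset.range (b + 1)
  have hbox : ∀ e ∈ box, e.1 ≤ a ∧ e.2 ≤ b := by
    intro e he
    simp only [box, Finset.mem_product, Finset.mem_range] at he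
    omega
  have hdisj : Disjoint box T := Finset.disjoint_left.2 fun e he heT =>
    absurd (hbox e he).1 (not_le.2 (hT e heT).1)
  have hcard : (box ∪ T).card = (a + 1) * (b + 1) + T.card := by
    rw [Finset.card_union_of_disjoint hdisj]
    simp [box]
  rw [← hcard]
  refine card_le_card_of_pointMoment_triangular A w u v _
    (fun e => if e.1 ≤ a then (a - e.1, b - e.2) else σ e)
    (fun e => if e.1 ≤ a then 2 * (e.1 + e.2) + 1 else 2 * (e.1 + e.2)) ?_ ?_
  · intro e he
    rcases Finset.mem_union.1 he with he | he
    · obtain ⟨h1, h2⟩ := hbox e he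
      simpa [h1, Nat.add_sub_cancel' h1, Nat.add_sub_cancel' h2] using hab
    · obtain ⟨h1, -, -, h4⟩ := hT e he
      simpa [not_le.2 h1] using h4
  · intro e he e' he' hne hwt
    refine hzero _ _ ?_ ?_ <;>
    · rcases Finset.mem_union.1 he with he | he <;> rcases Finset.mem_union.1 he' with he' | he'
      · have h := hbox e he
        have h' := hbox e' he'
        simp only [h.1, h'.1, if_true, ne_eq, Prod.ext_iff] at hwt hne ⊢
        omega
      · have h := hbox e he
        have h' := hT e' he'
        simp only [h.1, not_le.2 h'.1, if_true, if_false, ne_eq, Prod.ext_iff] at hwt hne ⊢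
        omega
      · have h := hT e he
        have h' := hbox e' he'
        simp only [h'.1, not_le.2 h.1, if_true, if_false, ne_eq, Prod.ext_iff] at hwt hne ⊢
        omega
      · have h := hT e he
        have h' := hT e' he'
        have hdeg : e'.1 + e'.2 ≠ e.1 + e.2 := fun hd => hne (hinj _ he' _ he hd)
        simp only [not_le.2 h.1, not_le.2 h'.1, if_false, ne_eq, Prod.ext_iff] at hwt hne ⊢
        omega

/-- The form `x * y ^ a * z ^ (a + 1 + ε) + y ^ (2 * a + 2) * z ^ ε`. -/
noncomputable def highRankForm (K : Type*) [Field K] (a ε : ℕ) : MvPolynomial (Fin 3) K :=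
  monomial (ternaryExponent 1 a (a + 1 + ε)) 1 + monomial (ternaryExponent 0 (2 * a + 2) ε) 1

theorem highRankForm_isHomogeneous (K : Type*) [Field K] (a ε : ℕ) :
    (highRankForm K a ε).IsHomogeneous (2 * a + 2 + ε) := by
  refine (isHomogeneous_monomial _ ?_).add (isHomogeneous_monomial _ ?_) <;>
    rw [ternaryExponent_degree] <;> ring

theorem le_waringRank_highRankForm (K : Type*) [Field K] [CharZero K] (a ε : ℕ) (hε : ε ≤ 1) :
    (a + 1) * (a + 2 + ε) + (1 + ε) ≤ waringRank (2 * a + 2 + ε) (highRankForm K a ε) := by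
  classical
  refine le_waringRank (highRankForm_isHomogeneous K a ε) fun r c ℓ hℓ hsum => ?_
  let α : Fin r → K := fun i => coeff (Finsupp.single 0 1) (ℓ i)
  let β : Fin r → K := fun i => coeff (Finsupp.single 1 1) (ℓ i)
  let γ : Fin r → K := fun i => coeff (Finsupp.single 2 1) (ℓ i)
  let A := Finset.univ.filter fun i => α i ≠ 0
  let B := Finset.univ.filter fun i => ¬ α i ≠ 0
  have hAB : A.card + B.card = r := by
    simpa [A, B] using Finset.card_filter_add_card_filter_not (s := Finset.univ) fun i => α i ≠ 0
  let μ := pointMoment A (fun i => c i * α i ^ (2 * a + 2 + ε)) (fun i => β i / α i)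
    (fun i => γ i / α i)
  have hcoeff : ∀ m p q, m + p + q = 2 * a + 2 + ε →
      coeff (ternaryExponent m p q) (highRankForm K a ε) =
        (ternaryExponent m p q).multinomial *
          (μ p q + ∑ i ∈ B, c i * (α i ^ m * β i ^ p * γ i ^ q)) := by
    intro m p q hd
    have hA : μ p q = ∑ i ∈ A, c i * (α i ^ m * β i ^ p * γ i ^ q) := by
      refine Finset.sum_congr rfl fun i hi => ?_
      have hαi : α i ≠ 0 := by simpa [A] using hi
      simp only [← hd, pow_add, div_pow]
      field_simp
    rw [hA, Finset.sum_filter_add_sum_filter_not, hsum, coeff_sum, Finset.mul_sum]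
    refine Finset.sum_congr rfl fun i _ => ?_
    rw [coeff_smul, ← hd, coeff_pow_of_isHomogeneous_one (hℓ i), smul_eq_mul]
    ring
  have hmult : ∀ m p q, ((ternaryExponent m p q).multinomial : K) ≠ 0 := fun m p q =>
    Nat.cast_ne_zero.2 (Nat.multinomial_pos _ _).ne'
  have hform : ∀ m p q, coeff (ternaryExponent m p q) (highRankForm K a ε) =
      (if 1 = m ∧ a = p ∧ a + 1 + ε = q then 1 else 0) +
        if 0 = m ∧ 2 * a + 2 = p ∧ ε = q then 1 else 0 := by
    intro m p q
    simp [highRankForm, coeff_monomial, ternaryExponent_inj]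
  have hBzero : ∀ m p q, m ≠ 0 → ∑ i ∈ B, c i * (α i ^ m * β i ^ p * γ i ^ q) = 0 := by
    intro m p q hm
    refine Finset.sum_eq_zero fun i hi => ?_
    have hαi : α i = 0 := by simpa [B] using hi
    simp [hαi, hm]
  have hab : μ a (a + 1 + ε) ≠ 0 := by
    intro h
    have := hcoeff 1 a (a + 1 + ε) (by ring)
    rw [h, hBzero 1 _ _ one_ne_zero, hform] at this
    simp at this
  have hzero : ∀ p q, p + q ≤ a + (a + 1 + ε) → (p, q) ≠ (a, a + 1 + ε) → μ p q = 0 := by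
    intro p q hpq hne
    obtain ⟨m, hm⟩ := Nat.exists_eq_add_of_le hpq
    have := hcoeff (m + 1) p q (by omega)
    rw [hBzero (m + 1) _ _ m.succ_ne_zero, hform, if_neg, if_neg] at this
    · simpa [hmult] using this
    · omega
    · rintro ⟨-, rfl, rfl⟩
      exact hne rfl
  have hbound := box_card_add_card_le_card A _ _ _ a (a + 1 + ε) hab hzero
  have htop : ∀ p q, p + q = 2 * a + 2 + ε →
      (if 2 * a + 2 = p ∧ ε = q then 1 else 0) =
        ((ternaryExponent 0 p q).multinomial : K) *
          (μ p q + ∑ i ∈ B, c i * (β i ^ p * γ i ^ q)) := by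
    intro p q hpq
    have := hcoeff 0 p q (by omega)
    simpa [hform] using this
  rcases hB : B.card with _ | _ | s
  · rw [Finset.card_eq_zero] at hB
    have hμ : μ (2 * a + 2) ε ≠ 0 := by
      intro h
      simpa [hB, h] using htop (2 * a + 2) ε rfl
    have hle := hbound ((Finset.range (1 + ε)).image fun j => (a + 1, j))
      (fun e => (a + 1, ε - e.2)) ?_ ?_
    · rw [Finset.card_image_of_injective _ (fun i j h => (Prod.ext_iff.1 h).2),
        Finset.card_range] at hle
      have : A.card ≤ r := by omega
      linarith
    · simp only [Finset.mem_image, Prod.ext_iff]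
      rintro e ⟨i, -, h1, -⟩ e' ⟨j, -, h1', -⟩ h
      omega
    · intro e he
      obtain ⟨j, hj, rfl⟩ := Finset.mem_image.1 he
      rw [Finset.mem_range] at hj
      refine ⟨by simp, by simp, by simp only; omega, ?_⟩
      have h1 : a + 1 + (a + 1) = 2 * a + 2 := by ring
      have h2 : j + (ε - j) = ε := by omega
      simpa only [h1, h2] using hμ
  · rcases Nat.le_one_iff_eq_zero_or_eq_one.1 hε with rfl | rfl
    · have hle := hbound ∅ id (by simp) (by simp)
      simp only [Finset.card_empty] at hle
      linarith
    · obtain ⟨i, hi⟩ := Finset.card_eq_one.1 hB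
      have h1 := htop (2 * a + 2) 1 rfl
      have h0 := htop (2 * a + 3) 0 rfl
      simp only [hi, Finset.sum_singleton] at h0 h1
      obtain ⟨p, q, hp, hpq, hμ⟩ : ∃ p q, a + 1 ≤ p ∧ p + q = a + 2 ∧ μ (a + 1 + p) q ≠ 0 := by
        by_contra! hall
        have hμ1 : μ (2 * a + 2) 1 = 0 := by
          convert hall (a + 1) 1 le_rfl rfl using 2
          ring
        have hμ0 : μ (2 * a + 3) 0 = 0 := by
          convert hall (a + 2) 0 (by omega) rfl using 2
          ring
        rw [hμ1] at h1
        rw [hμ0] at h0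
        have hcβ : c i * β i = 0 := by
          have : c i = 0 ∨ β i = 0 := by simpa [hmult] using h0
          simpa using this
        have : c i * (β i ^ (2 * a + 2) * γ i ^ 1) =
            (c i * β i) * (β i ^ (2 * a + 1) * γ i) := by ring
        rw [this, hcβ] at h1
        simp at h1
      have hle := hbound {(a + 1, 0)} (fun _ => (p, q)) (by simp) (by
        intro e he
        rw [Finset.mem_singleton] at he
        subst he
        refine ⟨by simp, hp, by simp only; omega, ?_⟩
        simpa using hμ)
      simp only [Finset.card_singleton] at hle
      linarith
  · have hle := hbound ∅ id (by simp) (by simp)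
    simp only [Finset.card_empty] at hle
    linarith

theorem max_waring_rank_lower_bound (K : Type*) [Field K] [IsAlgClosed K] [CharZero K]
    (d : ℕ) (hd : 2 ≤ d) :
    ∃ F : MvPolynomial (Fin 3) K, F.IsHomogeneous d ∧
      (d ^ 2 + 2 * d + 5) / 4 ≤ waringRank d F := by
  obtain ⟨a, ε, hε, rfl⟩ : ∃ a ε, ε ≤ 1 ∧ d = 2 * a + 2 + ε :=
    ⟨(d - 2) / 2, (d - 2) % 2, by omega, by omega⟩
  refine ⟨highRankForm K a ε, highRankForm_isHomogeneous K a ε,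
    le_trans ?_ (le_waringRank_highRankForm K a ε hε)⟩
  rw [← Nat.lt_succ_iff, Nat.div_lt_iff_lt_mul (by norm_num)]
  interval_cases ε <;> nlinarith
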